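/- Let p be a prime and n a positive integer with p ≥ 2n. Let x be a nilpotent n×n matrix over F_p, and let A ∈ GL_n(Z_p) be any matrix whose reduction modulo p equals exp(x) := ∑_{i=0}^{n-1} x^i / i!. Then for every positive integer k, every entry of A^{p^k} − 1 is divisible by p^k, and the reduction modulo p of the matrix (A^{p^k} − 1)/p^k equals x. Equivalently, A^{p^k} ≡ 1 + p^k·M (mod p^{k+1}) for some matrix M ∈ M_n(Z_p) whose reduction modulo p is x. -/

import Mathlib

open scoped Matrix

/-- The truncated exponential `exp x = ∑_{i<n} x^i / i!` of an `n × n` matrix over `𝔽_p`. -/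
noncomputable def truncExp (p n : ℕ) [Fact p.Prime]
    (x : Matrix (Fin n) (Fin n) (ZMod p)) : Matrix (Fin n) (Fin n) (ZMod p) :=
  ∑ i ∈ Finset.range n, ((Nat.factorial i : ZMod p)⁻¹) • x ^ i

open Polynomial in
/-- The polynomial `((1 + X) ^ p - 1 - X ^ p) / p` as `X * r`, with its derivative. -/
theorem exists_one_add_X_pow_prime_eq {p : ℕ} (hp : p.Prime) :
    ∃ r : ℤ[X], (1 + X) ^ p = 1 + X ^ p + (p : ℤ[X]) * (X * r) ∧
      derivative (X * r) = (1 + X) ^ (p - 1) - X ^ (p - 1) ∧ X ∣ r - 1 := by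
  obtain ⟨r, hr⟩ := exists_add_pow_prime_eq hp (1 : ℤ[X]) X
  have hr' : (1 + X) ^ p = 1 + X ^ p + (p : ℤ[X]) * (X * r) := by
    rw [hr]; ring
  have hd : derivative (X * r) = (1 + X) ^ (p - 1) - X ^ (p - 1) := by
    have hp0 : (p : ℤ[X]) ≠ 0 := by exact_mod_cast hp.ne_zero
    apply mul_left_cancel₀ hp0
    have := congrArg derivative hr'
    simp only [derivative_pow, derivative_add, derivative_mul, derivative_one, derivative_X,
      derivative_natCast, C_eq_natCast] at this ⊢
    linear_combination -this
  refine ⟨r, hr', hd, ?_⟩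
  rw [X_dvd_iff]
  have := congrArg (eval 0) hd
  have hp1 : p - 1 ≠ 0 := by have := hp.two_le; omega
  simp [hp1] at this
  rw [coeff_zero_eq_eval_zero]
  simp [this]

open Polynomial in
/-- A polynomial vanishing at `0` whose derivative is `1` modulo `X ^ (n - 1)` is `X` modulo
`X ^ n`, provided the characteristic is at least `n`. -/
theorem X_pow_dvd_sub_X_of_derivative {p n : ℕ} [Fact p.Prime] (hnp : n ≤ p) {f : (ZMod p)[X]}
    (h0 : X ∣ f) (hf : X ^ (n - 1) ∣ derivative f - 1) : X ^ n ∣ f - X := by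
  rw [X_pow_dvd_iff] at hf ⊢
  intro d hd
  rcases d with _ | d
  · simpa using X_dvd_iff.mp h0
  · have := hf d (by omega)
    have hdp : ((d + 1 : ℕ) : ZMod p) ≠ 0 := by
      rw [Ne, ZMod.natCast_eq_zero_iff]
      exact fun h => absurd (Nat.le_of_dvd d.succ_pos h) (by omega)
    rw [coeff_sub, coeff_derivative] at this
    rw [coeff_sub, coeff_X]
    rcases d with _ | d
    · simpa using this
    · simpa [coeff_one, show (d : ZMod p) + 1 + 1 ≠ 0 by simpa using hdp] using this

open Polynomial in
/-- The truncated exponential polynomial `∑_{i<n} X ^ i / i!` over `𝔽_p`. -/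
noncomputable def truncExpPoly (p n : ℕ) [Fact p.Prime] : (ZMod p)[X] :=
  ∑ i ∈ Finset.range n, C ((Nat.factorial i : ZMod p)⁻¹) * X ^ i

theorem aeval_truncExpPoly (p n : ℕ) [Fact p.Prime] (x : Matrix (Fin n) (Fin n) (ZMod p)) :
    Polynomial.aeval x (truncExpPoly p n) = truncExp p n x := by
  simp [truncExpPoly, truncExp, Algebra.smul_def]

open Polynomial in
theorem X_dvd_truncExpPoly_sub_one (p : ℕ) {n : ℕ} [Fact p.Prime] (hn : 0 < n) :
    X ∣ truncExpPoly p n - 1 := by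
  rw [X_dvd_iff]
  simp [truncExpPoly, finsetSum_coeff, coeff_X_pow, hn]

open Polynomial in
theorem X_pow_dvd_derivative_truncExpPoly_sub {p n : ℕ} [Fact p.Prime] (hnp : n ≤ p) :
    X ^ (n - 1) ∣ derivative (truncExpPoly p n) - truncExpPoly p n := by
  rw [X_pow_dvd_iff]
  intro d hd
  have hdp : ((d + 1 : ℕ) : ZMod p) ≠ 0 := by
    rw [Ne, ZMod.natCast_eq_zero_iff]
    exact fun h => absurd (Nat.le_of_dvd d.succ_pos h) (by omega)
  have hc (j : ℕ) (hj : j < n) : (truncExpPoly p n).coeff j = (Nat.factorial j : ZMod p)⁻¹ := by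
    simp [truncExpPoly, finsetSum_coeff, coeff_X_pow, hj]
  rw [coeff_sub, coeff_derivative, hc _ (by omega), hc _ (by omega), Nat.factorial_succ]
  push_cast at hdp ⊢
  rw [mul_inv, mul_right_comm, inv_mul_cancel₀ hdp, one_mul, sub_self]

open Polynomial in
/-- The truncated logarithm inverts the truncated exponential modulo `X ^ n`. -/
theorem X_pow_dvd_comp_truncExpPoly_sub_X {p n : ℕ} [Fact p.Prime] (hn : 0 < n) (hnp : n ≤ p)
    {g : (ZMod p)[X]} (hg0 : X ∣ g)
    (hg : derivative g = (1 + X) ^ (p - 1) - X ^ (p - 1)) :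
    X ^ n ∣ g.comp (truncExpPoly p n - 1) - X := by
  have hp1 : p - 1 + 1 = p := Nat.sub_add_cancel (Fact.out : p.Prime).one_le
  have hE := X_pow_dvd_derivative_truncExpPoly_sub hnp
  obtain ⟨b, hb⟩ := X_dvd_truncExpPoly_sub_one p hn
  set E := truncExpPoly p n
  apply X_pow_dvd_sub_X_of_derivative hnp
  · obtain ⟨c, rfl⟩ := hg0
    simp [hb, mul_assoc]
  have hcop : IsCoprime ((X : (ZMod p)[X]) ^ (n - 1)) E :=
    IsCoprime.pow_left ⟨-b, 1, by linear_combination hb⟩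
  refine hcop.dvd_of_dvd_mul_right ?_
  have hEp : E ^ p = 1 + (E - 1) ^ p := by
    rw [sub_pow_char, one_pow]; ring
  have hX : (X : (ZMod p)[X]) ^ (n - 1) ∣ (E - 1) ^ (p - 1) := by
    rw [hb, mul_pow]
    exact (pow_dvd_pow _ (by omega)).mul_right _
  have key : (derivative (g.comp (E - 1)) - 1) * E =
      (derivative E - E) + (E - 1) ^ (p - 1) * (- derivative E) := by
    rw [derivative_comp, hg]
    simp only [derivative_sub, derivative_one, sub_comp, add_comp, pow_comp, X_comp, one_comp]
    have h1 : E ^ p = E ^ (p - 1) * E := by rw [← pow_succ, hp1]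
    have h2 : (E - 1) ^ p = (E - 1) ^ (p - 1) * (E - 1) := by rw [← pow_succ, hp1]
    rw [add_sub_cancel]
    linear_combination derivative E * (hEp - h1 + h2)
  rw [key]
  exact dvd_add hE (hX.mul_right _)

open Polynomial in
/-- If `φ : S → T` has kernel `p S`, then the `p^k`-th powers of `1 + b`, where `b ^ p ∈ p² S`,
are `1 + p ^ k m`, with `m` lifting the truncated logarithm of `1 + φ b`. -/
theorem exists_one_add_pow_prime_pow_eq {p : ℕ} (hp : p.Prime) {S T : Type*} [Ring S] [Ring T]
    (φ : S →+* T) (hφp : φ p = 0) (hφ : ∀ y, φ y = 0 → ∃ z, y = p * z)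
    {r : ℤ[X]} (hr : (1 + X) ^ p = 1 + X ^ p + (p : ℤ[X]) * (X * r)) (hr1 : X ∣ r - 1)
    {b : S} (hb : ∃ c, b ^ p = p ^ 2 * c) (hnil : (eval₂ (Int.castRingHom T) (φ b) (X * r)) ^ p = 0)
    {k : ℕ} (hk : 1 ≤ k) :
    ∃ m : S, φ m = eval₂ (Int.castRingHom T) (φ b) (X * r) ∧ (1 + b) ^ p ^ k = 1 + p ^ k * m := by
  have hpow (y : S) : (1 + y) ^ p = 1 + y ^ p + p * (y * aeval y r) := by
    simpa using congrArg (aeval y) hr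
  induction k, hk using Nat.le_induction with
  | base =>
    obtain ⟨c, hc⟩ := hb
    refine ⟨aeval b (X * r) + p * c, ?_, ?_⟩
    · have : φ (aeval b (X * r)) = eval₂ (Int.castRingHom T) (φ b) (X * r) := by
        rw [aeval_def, hom_eval₂]
        congr 1
        exact RingHom.ext_int _ _
      rw [map_add φ, this, map_mul φ, hφp, zero_mul, add_zero]
    · rw [pow_one, hpow, hc, map_mul, aeval_X]
      noncomm_ring
  | succ k hk ih =>
    obtain ⟨m, hm, hmk⟩ := ih
    obtain ⟨c, hc⟩ := hφ (m ^ p) (by rw [map_pow, hm, hnil])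
    obtain ⟨s, hs⟩ := hr1
    have hs' : r = 1 + X * s := by linear_combination hs
    have hcomm : Commute ((p : S) ^ k) m := (Nat.cast_commute p m).pow_left k
    set q : S := (p : S) ^ k
    obtain ⟨j, hj⟩ : ∃ j, k * p = k + 1 + j := by
      apply Nat.exists_eq_add_of_le
      nlinarith [hp.two_le]
    obtain ⟨i, rfl⟩ : ∃ i, k = i + 1 := ⟨k - 1, by omega⟩
    refine ⟨m + p * (p ^ i * m * (m * aeval (q * m) s) + p ^ j * c), ?_, ?_⟩
    · rw [map_add, map_mul, hφp, zero_mul, add_zero, hm]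
    · rw [pow_succ, pow_mul, hmk, hpow, hcomm.mul_pow, ← pow_mul, hj, hc, hs']
      simp only [map_add, map_mul, map_one, aeval_X]
      have h1 : (p : S) ^ j * p = p * p ^ j := by rw [← pow_succ, pow_succ']
      have h2 : (p : S) * q = q * p := by rw [← pow_succ, pow_succ']
      have h3 : (p : S) * p ^ i = q := by rw [← pow_succ']
      have hc_term : (p : S) ^ (i + 1 + 1 + j) * (p * c) = q * p * (p * (p ^ j * c)) := by
        rw [pow_add, pow_succ, mul_assoc _ (_ ^ j), ← mul_assoc (_ ^ j), h1, mul_assoc (p : S)]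
      rw [hc_term, pow_succ (p : S)]
      change _ = 1 + q * p * _
      generalize aeval (q * m) s = t
      have ht : p * (q * m * (1 + q * m * t)) = q * p * (m + q * (m * (m * t))) := by
        rw [← h2, mul_add, mul_add, mul_one, mul_assoc q m t, mul_assoc q m (q * _),
          ← mul_assoc m q, ← hcomm.eq]
        noncomm_ring
      rw [ht, ← h3]
      noncomm_ring

theorem Matrix.pow_card_eq_zero_of_isNilpotent {ι K : Type*} [Fintype ι] [DecidableEq ι] [Field K]
    {x : Matrix ι ι K} (hx : IsNilpotent x) : x ^ Fintype.card ι = 0 := by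
  have h := (Matrix.isNilpotent_charpoly_sub_pow_of_isNilpotent hx).eq_zero
  simpa [sub_eq_zero.mp h] using x.aeval_self_charpoly

theorem PadicInt.exists_eq_natCast_mul_of_mapMatrix_toZMod_eq_zero {p : ℕ} [Fact p.Prime]
    {ι : Type*} [Fintype ι] [DecidableEq ι] (y : Matrix ι ι ℤ_[p])
    (hy : (PadicInt.toZMod (p := p)).mapMatrix y = 0) : ∃ z, y = p * z := by
  have h (i j) : ∃ c, y i j = p * c := by
    have hij : y i j ∈ RingHom.ker (PadicInt.toZMod (p := p)) := congrFun (congrFun hy i) j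
    rwa [PadicInt.ker_toZMod, PadicInt.maximalIdeal_eq_span_p, Ideal.mem_span_singleton] at hij
  choose z hz using h
  refine ⟨Matrix.of z, ?_⟩
  ext i j
  rw [← nsmul_eq_mul, Matrix.smul_apply, nsmul_eq_mul]
  exact hz i j

/-- Let `p ≥ 2n` be prime, `x` a nilpotent `n × n` matrix over `𝔽_p`, and `A ∈ GL_n(ℤ_p)`
a lift of `exp x`.  Then for every `k ≥ 1`, `A^(p^k) ≡ 1 + p^k • M (mod p^(k+1))` for some
matrix `M` over `ℤ_p` reducing to `x` modulo `p`. -/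
theorem pow_p_pow_k_congr (p n : ℕ) [hp : Fact p.Prime] (hn : 0 < n) (hpn : 2 * n ≤ p)
    (x : Matrix (Fin n) (Fin n) (ZMod p)) (hx : IsNilpotent x)
    (A : GL (Fin n) ℤ_[p])
    (hA : ((A : Matrix (Fin n) (Fin n) ℤ_[p])).map (PadicInt.toZMod) = truncExp p n x)
    (k : ℕ) (hk : 1 ≤ k) :
    ∃ M : Matrix (Fin n) (Fin n) ℤ_[p],
      M.map (PadicInt.toZMod) = x ∧
      ∀ i j : Fin n,
        (p : ℤ_[p]) ^ (k + 1) ∣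
          (((A : Matrix (Fin n) (Fin n) ℤ_[p]) ^ (p ^ k) - 1 - ((p : ℤ_[p]) ^ k) • M) i j) := by
  have hp' : p.Prime := hp.out
  have hxn : x ^ n = 0 := by simpa using Matrix.pow_card_eq_zero_of_isNilpotent hx
  have hvan {f : Polynomial (ZMod p)} (hf : Polynomial.X ^ n ∣ f) : Polynomial.aeval x f = 0 := by
    obtain ⟨g, rfl⟩ := hf
    simp [hxn]
  obtain ⟨r, hr, hd, hr1⟩ := exists_one_add_X_pow_prime_eq hp'
  let φ := (PadicInt.toZMod (p := p)).mapMatrix (m := Fin n)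
  set a : Matrix (Fin n) (Fin n) ℤ_[p] := ↑A
  have hb : φ (a - 1) = Polynomial.aeval x (truncExpPoly p n - 1) := by
    rw [map_sub, map_one, map_sub, map_one, aeval_truncExpPoly, ← hA]
    rfl
  have hlog : (Polynomial.X * r).eval₂ (Int.castRingHom _) (φ (a - 1)) = x := by
    have h := hvan (X_pow_dvd_comp_truncExpPoly_sub_X hn (by omega)
      (g := (Polynomial.X * r).map (Int.castRingHom (ZMod p))) (by simp)
      (by rw [Polynomial.derivative_map, hd]; simp))
    rw [map_sub, Polynomial.aeval_comp, ← hb, Polynomial.aeval_X, sub_eq_zero] at h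
    rw [← h, Polynomial.aeval_def, Polynomial.eval₂_map]
    congr 1
  have hker := PadicInt.exists_eq_natCast_mul_of_mapMatrix_toZMod_eq_zero (p := p) (ι := Fin n)
  have hbp : ∃ c, (a - 1) ^ p = p ^ 2 * c := by
    obtain ⟨z, hz⟩ := hker ((a - 1) ^ n) <| by
      change φ _ = 0
      rw [map_pow, hb, ← map_pow]
      exact hvan (pow_dvd_pow_of_dvd (X_dvd_truncExpPoly_sub_one p hn) n)
    refine ⟨z ^ 2 * (a - 1) ^ (p - n * 2), ?_⟩
    rw [← mul_assoc, ← (Nat.cast_commute p z).mul_pow, ← hz, ← pow_mul, ← pow_add]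
    congr 1; omega
  obtain ⟨M, hM, hMk⟩ := exists_one_add_pow_prime_pow_eq hp' φ (by
      rw [map_natCast]
      ext i j
      rw [← nsmul_one, Matrix.smul_apply]
      simp) hker hr hr1 hbp
    (by rw [hlog]; exact pow_eq_zero_of_le (by omega) hxn) hk
  refine ⟨M, hM.trans hlog, fun i j => ?_⟩
  rw [add_sub_cancel] at hMk
  have hsmul : (p : ℤ_[p]) ^ k • M = (p : Matrix (Fin n) (Fin n) ℤ_[p]) ^ k * M := by
    rw [← Nat.cast_pow, ← Nat.cast_pow, ← nsmul_eq_mul, Nat.cast_smul_eq_nsmul]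
  rw [hMk, hsmul, add_sub_cancel_left, sub_self]
  exact dvd_zero _
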